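/- Let T = (T_1,…,T_d) be a commuting row contraction on a complex Hilbert space H, and let H_u denote the smallest closed subspace of H containing every closed invariant subspace N ⊆ H on which the restricted tuple (T_1|_N,…,T_d|_N) is a spherical unitary. Then H_u is reducing for T and the restricted tuple (T_1|_{H_u},…,T_d|_{H_u}) is a spherical unitary on H_u. -/

import Mathlib

noncomputable section

open ContinuousLinearMap Filter

namespace RowCtr

variable {H : Type*} [NormedAddCommGroup H] [InnerProductSpace ℂ H] [CompleteSpace H]
variable {d : ℕ}

/-- A pairwise commuting tuple of operators. -/
def Commuting (T : Fin d → H →L[ℂ] H) : Prop := ∀ i j, Commute (T i) (T j)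

/-- A commuting row contraction: `∑ Tₖ Tₖ* ≤ 1` in the Loewner order. -/
def IsRowContraction (T : Fin d → H →L[ℂ] H) : Prop :=
  Commuting T ∧ (1 - ∑ k, T k ∘L adjoint (T k)).IsPositive

/-- A spherical unitary: commuting normal operators with `∑ Uₖ Uₖ* = 1`. -/
def IsSphericalUnitary (U : Fin d → H →L[ℂ] H) : Prop :=
  Commuting U ∧ (∀ k, U k ∘L adjoint (U k) = adjoint (U k) ∘L U k) ∧
    (∑ k, U k ∘L adjoint (U k)) = 1

/-- `T^α = T₁^{α₁} ⋯ T_d^{α_d}`. -/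
def mpow (T : Fin d → H →L[ℂ] H) (α : Fin d → ℕ) : H →L[ℂ] H :=
  (List.ofFn fun i => T i ^ α i).prod

/-- `∑_{|α| = N} (N!/α!) ‖T^{*α} ξ‖²`. -/
def defectSum (T : Fin d → H →L[ℂ] H) (N : ℕ) (ξ : H) : ℝ :=
  ∑ α ∈ Finset.Nat.antidiagonalTuple d N,
    (Nat.multinomial Finset.univ α : ℝ) * ‖adjoint (mpow T α) ξ‖ ^ 2

/-- A pure row contraction. -/
def IsPure (T : Fin d → H →L[ℂ] H) : Prop :=
  ∀ ξ : H, Tendsto (fun N => defectSum T N ξ) atTop (nhds 0)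

/-- `N` is invariant under every `T k`. -/
def Invar (T : Fin d → H →L[ℂ] H) (N : Submodule ℂ H) : Prop :=
  ∀ k, ∀ x ∈ N, T k x ∈ N

/-- `N` is reducing for the tuple `T`. -/
def Reduces (T : Fin d → H →L[ℂ] H) (N : Submodule ℂ H) : Prop :=
  Invar T N ∧ ∀ k, ∀ x ∈ N, adjoint (T k) x ∈ N

/-- Restriction of an operator to an invariant subspace. -/
def restrictCLM (f : H →L[ℂ] H) (N : Submodule ℂ H) (h : ∀ x ∈ N, f x ∈ N) :
    N →L[ℂ] N where
  toLinearMap := f.toLinearMap.restrict h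
  cont := (f.continuous.comp continuous_subtype_val).subtype_mk _

/-- Restriction of a tuple to a common invariant subspace. -/
def restrictTuple (T : Fin d → H →L[ℂ] H) (N : Submodule ℂ H) (h : Invar T N) :
    Fin d → N →L[ℂ] N := fun k => restrictCLM (T k) N (h k)

/-- `N` is a closed invariant subspace on which `T` restricts to a spherical unitary. -/
def RestrictsToSphericalUnitary (T : Fin d → H →L[ℂ] H) (N : Submodule ℂ H) : Prop :=
  ∃ (hc : IsClosed (N : Set H)) (hi : Invar T N),
    letI : CompleteSpace N := hc.completeSpace_coe
    IsSphericalUnitary (restrictTuple T N hi)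

/-- A completely non-unitary tuple. -/
def IsCompletelyNonUnitary (T : Fin d → H →L[ℂ] H) : Prop :=
  ∀ N : Submodule ℂ H, RestrictsToSphericalUnitary T N → N = ⊥

end RowCtr

namespace RowCtr

open scoped InnerProductSpace

section

variable {H : Type*} [NormedAddCommGroup H] [InnerProductSpace ℂ H]

@[simp]
theorem coe_restrictCLM_apply (f : H →L[ℂ] H) (N : Submodule ℂ H) (h : ∀ x ∈ N, f x ∈ N) (x : N) :
    (restrictCLM f N h x : H) = f x := rfl

theorem topologicalClosure_sSup_mem {f : H →L[ℂ] H} {S : Set (Submodule ℂ H)}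
    (h : ∀ N ∈ S, ∀ x ∈ N, f x ∈ N) :
    ∀ x ∈ (sSup S).topologicalClosure, f x ∈ (sSup S).topologicalClosure := by
  have hle : sSup S ≤ (sSup S).comap f.toLinearMap :=
    sSup_le fun N hN x hx => (le_sSup hN : N ≤ sSup S) (h N hN x hx)
  exact fun x hx => map_mem_closure f.continuous hx fun y hy => hle hy

variable [CompleteSpace H] {d : ℕ}

/-- On a reducing subspace, restriction commutes with taking adjoints. -/
theorem adjoint_restrictCLM (f : H →L[ℂ] H) (N : Submodule ℂ H) [CompleteSpace N]
    (h : ∀ x ∈ N, f x ∈ N) (h' : ∀ x ∈ N, adjoint f x ∈ N) :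
    adjoint (restrictCLM f N h) = restrictCLM (adjoint f) N h' := by
  symm
  rw [eq_adjoint_iff]
  intro x y
  simp [Submodule.coe_inner, adjoint_inner_left]

/-- The adjoint of a restriction is the compression of the adjoint. -/
theorem norm_adjoint_sub_adjoint_restrictCLM_sq (f : H →L[ℂ] H) (N : Submodule ℂ H)
    [CompleteSpace N] (h : ∀ x ∈ N, f x ∈ N) (y : N) :
    ‖adjoint f (y : H) - (adjoint (restrictCLM f N h) y : N)‖ ^ 2 =
      ‖adjoint f (y : H)‖ ^ 2 - ‖adjoint (restrictCLM f N h) y‖ ^ 2 := by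
  have key : ⟪adjoint f (y : H), ((adjoint (restrictCLM f N h) y : N) : H)⟫_ℂ =
      ⟪adjoint (restrictCLM f N h) y, adjoint (restrictCLM f N h) y⟫_ℂ := by
    rw [adjoint_inner_left, adjoint_inner_left, Submodule.coe_inner, coe_restrictCLM_apply]
  rw [norm_sub_sq (𝕜 := ℂ), key, inner_self_eq_norm_sq, Submodule.coe_norm]
  ring

theorem re_inner_sum_comp_adjoint (T : Fin d → H →L[ℂ] H) (x : H) :
    RCLike.re ⟪(∑ k, T k ∘L adjoint (T k)) x, x⟫_ℂ = ∑ k, ‖adjoint (T k) x‖ ^ 2 := by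
  simp only [sum_apply, sum_inner, map_sum, comp_apply]
  refine Finset.sum_congr rfl fun k _ => ?_
  rw [← adjoint_inner_right, inner_self_eq_norm_sq]

theorem IsRowContraction.sum_norm_adjoint_sq_le {T : Fin d → H →L[ℂ] H} (hT : IsRowContraction T)
    (x : H) : ∑ k, ‖adjoint (T k) x‖ ^ 2 ≤ ‖x‖ ^ 2 := by
  have h := hT.2.re_inner_nonneg_left x
  rw [sub_apply, inner_sub_left, map_sub, re_inner_sum_comp_adjoint, one_apply_eq_self,
    inner_self_eq_norm_sq] at h
  linarith

/-- A subspace on which a row contraction restricts to a spherical unitary is reducing. -/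
theorem RestrictsToSphericalUnitary.reduces {T : Fin d → H →L[ℂ] H} (hT : IsRowContraction T)
    {N : Submodule ℂ H} (hN : RestrictsToSphericalUnitary T N) : Reduces T N := by
  obtain ⟨hc, hi, -, -, hs⟩ := hN
  have : CompleteSpace N := hc.completeSpace_coe
  refine ⟨hi, fun k x hx => ?_⟩
  lift x to N using hx
  have h1 := hT.sum_norm_adjoint_sq_le (x : H)
  have h2 := re_inner_sum_comp_adjoint (restrictTuple T N hi) x
  rw [hs, one_apply_eq_self, inner_self_eq_norm_sq] at h2
  have h3 : ∑ k, ‖adjoint (T k) (x : H) - (adjoint (restrictTuple T N hi k) x : N)‖ ^ 2 ≤ 0 := by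
    simp only [restrictTuple, norm_adjoint_sub_adjoint_restrictCLM_sq, Finset.sum_sub_distrib]
    simp only [restrictTuple, Submodule.coe_norm] at h1 h2 ⊢
    linarith
  have h4 := (Finset.single_le_sum (f := fun k =>
    ‖adjoint (T k) (x : H) - (adjoint (restrictTuple T N hi k) x : N)‖ ^ 2)
    (fun _ _ => sq_nonneg _) (Finset.mem_univ k)).trans h3
  rw [sub_eq_zero.1 (norm_eq_zero.1 (pow_eq_zero_iff two_ne_zero |>.1 (h4.antisymm (sq_nonneg _))))]
  exact Subtype.prop _

/-- The subspace of vectors at which `T` satisfies the defining identities of a spherical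
unitary. -/
def sphericalLocus (T : Fin d → H →L[ℂ] H) : Submodule ℂ H :=
  (⨅ k, (T k ∘L adjoint (T k) - adjoint (T k) ∘L T k).ker) ⊓
    (∑ k, T k ∘L adjoint (T k) - 1).ker

theorem mem_sphericalLocus {T : Fin d → H →L[ℂ] H} {x : H} :
    x ∈ sphericalLocus T ↔ (∀ k, T k (adjoint (T k) x) = adjoint (T k) (T k x)) ∧
      ∑ k, T k (adjoint (T k) x) = x := by
  simp [sphericalLocus, sub_eq_zero, Submodule.mem_iInf]

theorem isClosed_sphericalLocus (T : Fin d → H →L[ℂ] H) :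
    IsClosed (sphericalLocus T : Set H) := by
  rw [sphericalLocus, Submodule.coe_inf, Submodule.coe_iInf]
  exact (isClosed_iInter fun k => isClosed_ker _).inter (isClosed_ker _)

/-- `T` restricts to a spherical unitary on a closed reducing subspace exactly when that
subspace lies in the spherical locus. -/
theorem Reduces.restrictsToSphericalUnitary_iff {T : Fin d → H →L[ℂ] H} (hT : Commuting T)
    {N : Submodule ℂ H} (hc : IsClosed (N : Set H)) (hN : Reduces T N) :
    RestrictsToSphericalUnitary T N ↔ N ≤ sphericalLocus T := by
  have : CompleteSpace N := hc.completeSpace_coe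
  have hadj (k) : adjoint (restrictTuple T N hN.1 k) = restrictCLM (adjoint (T k)) N (hN.2 k) :=
    adjoint_restrictCLM _ _ _ _
  constructor
  · rintro ⟨_, hi, -, hn, hs⟩ x hx
    simp only [hadj] at hn hs
    refine mem_sphericalLocus.2 ⟨fun k => ?_, ?_⟩
    · exact congrArg Subtype.val (DFunLike.congr_fun (hn k) ⟨x, hx⟩)
    · simpa [restrictTuple] using congrArg Subtype.val (DFunLike.congr_fun hs ⟨x, hx⟩)
  · intro h
    refine ⟨hc, hN.1, fun i j => ?_, fun k => ?_, ?_⟩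
    · ext x
      exact DFunLike.congr_fun (hT i j) (x : H)
    · rw [hadj]
      ext x
      exact (mem_sphericalLocus.1 (h x.2)).1 k
    · simp only [hadj]
      ext x
      simpa [restrictTuple] using (mem_sphericalLocus.1 (h x.2)).2

theorem Reduces.topologicalClosure_sSup {T : Fin d → H →L[ℂ] H} {S : Set (Submodule ℂ H)}
    (h : ∀ N ∈ S, Reduces T N) : Reduces T (sSup S).topologicalClosure :=
  ⟨fun k => topologicalClosure_sSup_mem fun N hN => (h N hN).1 k,
    fun k => topologicalClosure_sSup_mem fun N hN => (h N hN).2 k⟩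

end

/-- The smallest closed subspace containing every closed invariant subspace on
which the commuting row contraction `T` restricts to a spherical unitary is itself reducing
for `T`, and `T` restricts to a spherical unitary on it. -/
theorem sup_sphericalUnitary_subspaces
    {H : Type*} [NormedAddCommGroup H] [InnerProductSpace ℂ H] [CompleteSpace H]
    {d : ℕ} (T : Fin d → H →L[ℂ] H) (hT : IsRowContraction T) :
    Reduces T (sSup {N : Submodule ℂ H | RestrictsToSphericalUnitary T N}).topologicalClosure ∧
    RestrictsToSphericalUnitary T
      (sSup {N : Submodule ℂ H | RestrictsToSphericalUnitary T N}).topologicalClosure := by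
  have hred : Reduces T
      (sSup {N : Submodule ℂ H | RestrictsToSphericalUnitary T N}).topologicalClosure :=
    Reduces.topologicalClosure_sSup fun N hN => hN.reduces hT
  refine ⟨hred, (hred.restrictsToSphericalUnitary_iff hT.1
    (Submodule.isClosed_topologicalClosure _)).2 ?_⟩
  refine Submodule.topologicalClosure_minimal _ (sSup_le fun N hN => ?_)
    (isClosed_sphericalLocus T)
  exact ((hN.reduces hT).restrictsToSphericalUnitary_iff hT.1 hN.1).1 hN

end RowCtr
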